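/- arXiv:1910.07281 — 2 statements merged into one kernel-verified Lean document; each statement's English description precedes it below -/
import Mathlib

section
/- For all positive integers r, d and n with r < d ≤ 2r - 2 and n ≥ 3r - 1, there exists a radially maximal graph of radius r, diameter d and order n. -/
open SimpleGraph

/-- The eccentricity of a vertex `v`: the maximum distance from `v` to any vertex. -/
noncomputable def eccentricity {V : Type*} [Fintype V] (G : SimpleGraph V) (v : V) : ℕ :=
  Finset.univ.sup fun u => G.dist v u

/-- The radius of a graph: the minimum eccentricity over all vertices. -/
noncomputable def graphRadius {V : Type*} [Fintype V] (G : SimpleGraph V) : ℕ :=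
  ⨅ v, eccentricity G v

/-- The diameter of a graph: the maximum eccentricity over all vertices. -/
noncomputable def graphDiam {V : Type*} [Fintype V] (G : SimpleGraph V) : ℕ :=
  Finset.univ.sup fun v => eccentricity G v

/-- A connected graph is radially maximal if it is not complete and adding
any edge of the complement strictly decreases the radius. -/
def RadiallyMaximal {V : Type*} [Fintype V] (G : SimpleGraph V) : Prop :=
  G.Connected ∧ G ≠ ⊤ ∧ ∀ u v : V, u ≠ v → ¬ G.Adj u v →
    graphRadius (G ⊔ SimpleGraph.edge u v) < graphRadius G

/-- There is a walk of length at most `k`. -/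
def RR {V : Type*} (G : SimpleGraph V) (k : ℕ) (a b : V) : Prop :=
  ∃ w : G.Walk a b, w.length ≤ k

lemma RR.trans {V : Type*} {G : SimpleGraph V} {k l : ℕ} {a b c : V}
    (h1 : RR G k a b) (h2 : RR G l b c) : RR G (k + l) a c := by
  obtain ⟨w, hw⟩ := h1
  obtain ⟨w', hw'⟩ := h2
  exact ⟨w.append w', by rw [Walk.length_append]; omega⟩

lemma RR.symm {V : Type*} {G : SimpleGraph V} {k : ℕ} {a b : V}
    (h1 : RR G k a b) : RR G k b a := by
  obtain ⟨w, hw⟩ := h1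
  exact ⟨w.reverse, by rw [Walk.length_reverse]; omega⟩

lemma RR.mono {V : Type*} {G : SimpleGraph V} {k l : ℕ} {a b : V}
    (h1 : RR G k a b) (h : k ≤ l) : RR G l a b := by
  obtain ⟨w, hw⟩ := h1
  exact ⟨w, by omega⟩

lemma RR.refl {V : Type*} {G : SimpleGraph V} (k : ℕ) (a : V) : RR G k a a :=
  ⟨Walk.nil, by simp⟩

lemma RR.adj {V : Type*} {G : SimpleGraph V} {a b : V} (h : G.Adj a b) : RR G 1 a b :=
  ⟨Walk.cons h Walk.nil, by simp⟩

lemma RR.le {V : Type*} {G G' : SimpleGraph V} (h : G ≤ G') {k : ℕ} {a b : V}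
    (h1 : RR G k a b) : RR G' k a b := by
  obtain ⟨w, hw⟩ := h1
  exact ⟨w.mapLe h, by simpa using hw⟩

lemma RR.dist_le {V : Type*} {G : SimpleGraph V} {k : ℕ} {a b : V}
    (h1 : RR G k a b) : G.dist a b ≤ k := by
  obtain ⟨w, hw⟩ := h1
  exact (SimpleGraph.dist_le w).trans hw

lemma lip {V : Type*} {G : SimpleGraph V} (g : V → ℕ)
    (hg : ∀ a b, G.Adj a b → g a ≤ g b + 1) {a b : V} (w : G.Walk a b) :
    g a ≤ g b + w.length := by
  induction w with
  | nil => simp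
  | cons h w ih =>
    have := hg _ _ h
    rw [Walk.length_cons]
    omega

/-- Distance on a cycle of length `2r-1`. -/
def cd (r p q : ℕ) : ℕ := min ((p - q) + (q - p)) (2 * r - 1 - ((p - q) + (q - p)))

/-- Position of single leaves. -/
def Leaf (r b p : ℕ) : Prop :=
  (r + 1 ≤ p ∧ p ≤ 2 * r - 2 ∧ p + 3 + 2 * b ≤ 3 * r ∧ (p - r) % 2 = 1) ∨
    (p + 2 + 2 * b ≤ r ∧ (r - p) % 2 = 0)

def Vld (r b p h : ℕ) : Prop :=
  p < 2 * r - 1 ∧ (h = 0 ∨ (p = r ∧ h = 1) ∨ (Leaf r b p ∧ h = 1) ∨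
    (p + 1 + b = r ∧ 1 ≤ h ∧ h ≤ b))

def AdjP (r p h p' h' : ℕ) : Prop :=
  (h = 0 ∧ h' = 0 ∧ cd r p p' ≤ 1) ∨ (p = p' ∧ (h = h' + 1 ∨ h' = h + 1)) ∨
    (p = r ∧ h = 1 ∧ p' + 1 = r ∧ h' = 0) ∨ (p' = r ∧ h' = 1 ∧ p + 1 = r ∧ h = 0)

lemma cd_comm (r p q : ℕ) : cd r p q = cd r q p := by
  unfold cd; rw [add_comm (p - q)]

lemma cd_lip (r p p' q : ℕ) (hp : p < 2 * r - 1) (hp' : p' < 2 * r - 1) (hq : q < 2 * r - 1)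
    (h : cd r p p' ≤ 1) : cd r p q ≤ cd r p' q + 1 := by
  unfold cd at *
  omega

/-- The data of a graph. -/
structure Dat (V : Type*) (r b : ℕ) where
  pos : V → ℕ
  h : V → ℕ
  hr : 3 ≤ r
  hb : 1 ≤ b
  hbr : b + 2 ≤ r
  vld : ∀ v, Vld r b (pos v) (h v)
  surj : ∀ p k, Vld r b p k → ∃ v, pos v = p ∧ h v = k
  inj : ∀ v w, 1 ≤ h v → pos v = pos w → h v = h w → v = w

namespace Dat

variable {V : Type*} {r b : ℕ} (D : Dat V r b)

def G : SimpleGraph V where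
  Adj u v := u ≠ v ∧ AdjP r (D.pos u) (D.h u) (D.pos v) (D.h v)
  symm := ⟨by
    rintro u v ⟨h1, h2⟩
    refine ⟨h1.symm, ?_⟩
    unfold AdjP at *
    rw [cd_comm]
    tauto⟩
  loopless := ⟨by rintro u ⟨h, _⟩; exact h rfl⟩

lemma cyc_up (k : ℕ) : ∀ a c : V, D.h a = 0 → D.h c = 0 → 1 ≤ k →
    (D.pos c = D.pos a + k ∨ D.pos c + (2 * r - 1) = D.pos a + k) → RR D.G k a c := by
  have hr := D.hr
  induction k with
  | zero => intro a c _ _ h; omega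
  | succ k ih =>
    intro a c ha hc _ h
    have hva := D.vld a
    have hvc := D.vld c
    unfold Vld at hva hvc
    rcases Nat.eq_zero_or_pos k with hk | hk
    · subst hk
      apply RR.adj
      refine ⟨?_, Or.inl ⟨ha, hc, ?_⟩⟩
      · rintro rfl; omega
      · unfold cd; omega
    · obtain ⟨m, hm1, hm2⟩ := D.surj (if D.pos c = 0 then 2 * r - 2 else D.pos c - 1) 0
        (by unfold Vld; split_ifs <;> omega)
      have h1 : RR D.G k a m := by
        apply ih a m ha hm2 hk
        split_ifs at hm1 <;> omega
      have h2 : RR D.G 1 m c := by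
        apply RR.adj
        refine ⟨?_, Or.inl ⟨hm2, hc, ?_⟩⟩
        · rintro rfl; split_ifs at hm1 <;> omega
        · unfold cd; split_ifs at hm1 <;> omega
      exact h1.trans h2

lemma cyc (a c : V) (ha : D.h a = 0) (hc : D.h c = 0) (h : a = c ∨ D.pos a ≠ D.pos c) :
    RR D.G (cd r (D.pos a) (D.pos c)) a c := by
  have hr := D.hr
  have hva := D.vld a
  have hvc := D.vld c
  unfold Vld at hva hvc
  rcases h with rfl | h
  · exact RR.refl _ _
  · have : cd r (D.pos a) (D.pos c) = D.pos c - D.pos a + (D.pos a - D.pos c) ∨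
        cd r (D.pos a) (D.pos c) = 2 * r - 1 - (D.pos c - D.pos a + (D.pos a - D.pos c)) := by
      unfold cd; omega
    rcases Nat.lt_or_gt_of_ne h with h' | h' <;> rcases this with h2 | h2 <;> rw [h2]
    · apply D.cyc_up _ a c ha hc <;> omega
    · apply RR.symm; apply D.cyc_up _ c a hc ha <;> omega
    · apply RR.symm; apply D.cyc_up _ c a hc ha <;> omega
    · apply D.cyc_up _ a c ha hc <;> omega

lemma cyc1 (a c : V) (ha : D.h a = 0) (hc : D.h c = 0) :
    RR D.G (max 1 (cd r (D.pos a) (D.pos c))) a c := by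
  by_cases h : D.pos a = D.pos c
  · by_cases h' : a = c
    · subst h'; exact RR.refl _ _
    · refine RR.mono (RR.adj ⟨h', Or.inl ⟨ha, hc, ?_⟩⟩) (le_max_left _ _)
      rw [h]; unfold cd; omega
  · exact (D.cyc a c ha hc (Or.inr h)).mono (le_max_right _ _)

lemma up (k : ℕ) : ∀ a c : V, D.pos a = D.pos c → D.h c = D.h a + (k + 1) →
    RR D.G (k + 1) a c := by
  have hr := D.hr
  induction k with
  | zero =>
    intro a c h1 h2
    refine RR.adj ⟨?_, Or.inr (Or.inl ⟨h1, Or.inr h2⟩)⟩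
    rintro rfl; omega
  | succ k ih =>
    intro a c h1 h2
    have hvc := D.vld c
    obtain ⟨m, hm1, hm2⟩ := D.surj (D.pos c) (D.h c - 1) (by
      unfold Vld at *
      refine ⟨hvc.1, ?_⟩
      rcases hvc.2 with h | h | h | h
      · omega
      · omega
      · omega
      · right; right; right; omega)
    have e1 := ih a m (by omega) (by omega)
    refine e1.trans (RR.adj ⟨?_, Or.inr (Or.inl ⟨hm1, Or.inr (by omega)⟩)⟩)
    rintro rfl; omega

lemma same (a c : V) (h : D.pos a = D.pos c) (h' : 1 ≤ D.h a ∨ 1 ≤ D.h c) :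
    RR D.G ((D.h a - D.h c) + (D.h c - D.h a)) a c := by
  rcases lt_trichotomy (D.h a) (D.h c) with h1 | h1 | h1
  · exact (D.up (D.h c - D.h a - 1) a c h (by omega)).mono (by omega)
  · have : a = c := D.inj a c (by omega) h h1
    subst this; exact RR.refl _ _
  · exact (D.up (D.h a - D.h c - 1) c a h.symm (by omega)).symm.mono (by omega)

/-- From a cycle vertex to a tail vertex. -/
lemma ct (a c : V) (ha : D.h a = 0) (hc : 1 ≤ D.h c) :
    RR D.G (cd r (D.pos a) (D.pos c) + D.h c) a c := by
  have hvc := D.vld c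
  by_cases h : D.pos a = D.pos c
  · exact (D.same a c h (Or.inr hc)).mono (by omega)
  · obtain ⟨m, hm1, hm2⟩ := D.surj (D.pos c) 0 ⟨hvc.1, Or.inl rfl⟩
    have h1 := D.cyc a m ha hm2 (Or.inr (by omega))
    have h2 := D.same m c hm1 (Or.inr hc)
    rw [hm1] at h1
    exact (h1.trans h2).mono (by omega)

lemma ctA (a c : V) (ha : D.h a = 0) (hc : D.h c = 1) (hc' : D.pos c = r) :
    RR D.G (cd r (D.pos a) (r - 1) + 1) a c := by
  have hr := D.hr
  have key : ∀ m : V, D.h m = 0 → D.pos m = r - 1 → D.G.Adj m c := by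
    intro m h1 h2
    refine ⟨?_, Or.inr (Or.inr (Or.inr ⟨hc', hc, by omega, h1⟩))⟩
    rintro rfl; omega
  by_cases h : D.pos a = r - 1
  · exact (RR.adj (key a ha h)).mono (by omega)
  · obtain ⟨m, hm1, hm2⟩ := D.surj (r - 1) 0 ⟨by omega, Or.inl rfl⟩
    have h1 := D.cyc a m ha hm2 (Or.inr (by omega))
    rw [hm1] at h1
    exact h1.trans (RR.adj (key m hm2 hm1))

/-- Any two vertices. -/
lemma gen (a c : V) (h : D.pos a ≠ D.pos c) :
    RR D.G (D.h a + cd r (D.pos a) (D.pos c) + D.h c) a c := by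
  by_cases hc : D.h c = 0
  · by_cases ha : D.h a = 0
    · exact (D.cyc a c ha hc (Or.inr h)).mono (by omega)
    · have := (D.ct c a hc (by omega)).symm
      rw [cd_comm] at this
      exact this.mono (by omega)
  · obtain ⟨m, hm1, hm2⟩ := D.surj (D.pos a) 0 ⟨(D.vld a).1, Or.inl rfl⟩
    have h2 := D.ct m c hm2 (by omega)
    rw [hm1] at h2
    by_cases ha : D.h a = 0
    · have h2 := D.ct a c ha (by omega)
      exact h2.mono (by omega)
    · have h1 := D.same a m hm1.symm (Or.inl (by omega))
      exact (h1.trans h2).mono (by omega)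

lemma bound (a c : V) : RR D.G (r + b) a c := by
  have hr := D.hr
  have hb := D.hb
  have hva := D.vld a
  have hvc := D.vld c
  unfold Vld at hva hvc
  by_cases h : D.pos a = D.pos c
  · by_cases h' : 1 ≤ D.h a ∨ 1 ≤ D.h c
    · exact (D.same a c h h').mono (by omega)
    · refine (D.cyc1 a c (by omega) (by omega)).mono ?_
      unfold cd; omega
  · refine (D.gen a c h).mono ?_
    unfold cd; omega

lemma conn [Nonempty V] : D.G.Connected := by
  refine ⟨fun a c => ?_⟩
  obtain ⟨w, _⟩ := D.bound a c
  exact ⟨w⟩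

/-! Lower bounds -/

def gT (q l : ℕ) (v : V) : ℕ :=
  if D.pos v = q then l - D.h v
  else if D.pos v = r ∧ D.h v = 1 then l + 1 + min (cd r r q) (cd r (r - 1) q)
  else l + D.h v + cd r (D.pos v) q

def gA (v : V) : ℕ :=
  if D.pos v = r ∧ D.h v = 1 then 0
  else D.h v + 1 + min (cd r (D.pos v) r) (cd r (D.pos v) (r - 1))

lemma vr (v : V) (h : D.pos v = r) : D.h v ≤ 1 := by
  have hv := D.vld v
  unfold Vld Leaf at hv
  omega

lemma gA_lip (a c : V) (h : D.G.Adj a c) : D.gA a ≤ D.gA c + 1 := by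
  have hr := D.hr
  have hva := (D.vld a).1
  have hvc := (D.vld c).1
  have hra := D.vr a
  have hrc := D.vr c
  obtain ⟨_, h⟩ := h
  unfold gA
  unfold AdjP at h
  generalize D.pos a = p at *
  generalize D.h a = x at *
  generalize D.pos c = p' at *
  generalize D.h c = x' at *
  have z1 : cd r r r = 0 := by unfold cd; omega
  have z2 : cd r (r - 1) (r - 1) = 0 := by unfold cd; omega
  rcases h with ⟨rfl, rfl, h⟩ | ⟨rfl, h⟩ | ⟨rfl, rfl, h, rfl⟩ | ⟨rfl, rfl, h, rfl⟩
  · have h1 := cd_lip r p p' r hva hvc (by omega) h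
    have h2 := cd_lip r p p' (r - 1) hva hvc (by omega) h
    rw [if_neg (by omega), if_neg (by omega)]
    omega
  · by_cases hp : p = r
    · have := hra hp
      have := hrc hp
      subst hp
      rw [z1]
      split_ifs <;> omega
    · rw [if_neg (by omega), if_neg (by omega)]
      omega
  · rw [if_pos ⟨rfl, rfl⟩]; omega
  · rw [if_neg (by omega), if_pos ⟨rfl, rfl⟩, show p = p' - 1 by omega, z2]; omega

lemma gT_lip (q l : ℕ) (hq : q < 2 * r - 1) (hq1 : q ≠ r) (hq2 : q + 1 ≠ r) (a c : V)
    (h : D.G.Adj a c) : D.gT q l a ≤ D.gT q l c + 1 := by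
  have hr := D.hr
  have hva := (D.vld a).1
  have hvc := (D.vld c).1
  have hra := D.vr a
  have hrc := D.vr c
  obtain ⟨_, h⟩ := h
  unfold gT
  unfold AdjP at h
  generalize D.pos a = p at *
  generalize D.h a = x at *
  generalize D.pos c = p' at *
  generalize D.h c = x' at *
  have z1 : cd r q q = 0 := by unfold cd; omega
  have z3 := cd_lip r r (r - 1) q (by omega) (by omega) hq (by unfold cd; omega)
  have z4 := cd_lip r (r - 1) r q (by omega) (by omega) hq (by unfold cd; omega)
  rcases h with ⟨rfl, rfl, h⟩ | ⟨rfl, h⟩ | ⟨rfl, rfl, h, rfl⟩ | ⟨rfl, rfl, h, rfl⟩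
  · have h1 := cd_lip r p p' q hva hvc hq h
    rw [if_neg (c := p = r ∧ 0 = 1) (by omega), if_neg (c := p' = r ∧ 0 = 1) (by omega)]
    split_ifs with e1 e2 e2
    · omega
    · subst e1; omega
    · subst e2; rw [z1] at h1; omega
    · omega
  · by_cases hp : p = r
    · have := hra hp
      have := hrc hp
      subst hp
      split_ifs <;> omega
    · rw [if_neg (c := p = r ∧ x = 1) (by omega), if_neg (c := p = r ∧ x' = 1) (by omega)]
      split_ifs <;> omega
  · have : p' = p - 1 := by omega
    subst this
    rw [if_neg (by omega), if_pos ⟨rfl, rfl⟩, if_neg (by omega), if_neg (by omega)]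
    omega
  · have : p = p' - 1 := by omega
    subst this
    rw [if_neg (by omega), if_neg (by omega), if_neg (by omega), if_pos ⟨rfl, rfl⟩]
    omega

lemma low (q l : ℕ) (hq1 : q ≠ r) (hq2 : q + 1 ≠ r) (hl : Vld r b q l) :
    ∃ w, D.pos w = q ∧ D.h w = l ∧ ∀ v, ∀ k, RR D.G k v w → D.gT q l v ≤ k := by
  obtain ⟨w, h1, h2⟩ := D.surj q l hl
  refine ⟨w, h1, h2, fun v k ⟨W, hW⟩ => ?_⟩
  have := lip _ (D.gT_lip q l hl.1 hq1 hq2) W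
  have h0 : D.gT q l w = 0 := by unfold gT; rw [if_pos h1]; omega
  omega

lemma lowA :
    ∃ w, ∀ v, ∀ k, RR D.G k v w → D.gA v ≤ k := by
  have hr := D.hr
  obtain ⟨w, h1, h2⟩ := D.surj r 1 ⟨by omega, Or.inr (Or.inl ⟨rfl, rfl⟩)⟩
  refine ⟨w, fun v k ⟨W, hW⟩ => ?_⟩
  have := lip _ (D.gA_lip) W
  have h0 : D.gA w = 0 := by unfold gA; rw [if_pos ⟨h1, h2⟩]
  omega

lemma far (v : V) : ∃ w, ∀ k, RR D.G k v w → r ≤ k := by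
  have hr := D.hr
  have hb := D.hb
  have hbr := D.hbr
  have hv := D.vld v
  by_cases h0 : D.pos v = 0
  · obtain ⟨w, hw⟩ := D.lowA
    refine ⟨w, fun k hk => le_trans ?_ (hw v k hk)⟩
    unfold gA; unfold cd; rw [h0]; split_ifs <;> omega
  by_cases h1 : D.pos v ≤ 2 * r - 2 - 2 * b
  · obtain ⟨q, hq⟩ : ∃ q, q = if r + 2 * ((D.pos v + 1) / 2) - 1 < 2 * r - 1 then
        r + 2 * ((D.pos v + 1) / 2) - 1 else 2 * ((D.pos v + 1) / 2) - r := ⟨_, rfl⟩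
    have hL : Leaf r b q := by
      unfold Leaf; split_ifs at hq <;> omega
    obtain ⟨w, hw1, hw2, hw⟩ := D.low q 1 (by unfold Leaf at hL; omega)
      (by unfold Leaf at hL; omega)
      ⟨by unfold Leaf at hL; omega, Or.inr (Or.inr (Or.inl ⟨hL, rfl⟩))⟩
    refine ⟨w, fun k hk => le_trans ?_ (hw v k hk)⟩
    unfold gT
    have := hv.1
    generalize D.pos v = p at *
    unfold cd
    split_ifs at hq <;> split_ifs <;> omega
  · obtain ⟨w, hw1, hw2, hw⟩ := D.low (r - 1 - b) b (by omega)
      (by omega)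
      ⟨by omega, Or.inr (Or.inr (Or.inr ⟨by omega, by omega, by omega⟩))⟩
    refine ⟨w, fun k hk => le_trans ?_ (hw v k hk)⟩
    unfold gT
    have := hv.1
    generalize D.pos v = p at *
    unfold cd
    split_ifs <;> omega

lemma diamLow : ∃ v w, ∀ k, RR D.G k v w → r + b ≤ k := by
  have hr := D.hr
  have hb := D.hb
  have hbr := D.hbr
  obtain ⟨w, hw1, hw2, hw⟩ := D.low (r - 1 - b) b (by omega)
      (by omega)
      ⟨by omega, Or.inr (Or.inr (Or.inr ⟨by omega, by omega, by omega⟩))⟩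
  obtain ⟨q, hq⟩ : ∃ q, q = if (r - b) % 2 = 0 then 2 * r - 1 - b else 2 * r - 2 - b := ⟨_, rfl⟩
  have hL : Leaf r b q := by
      unfold Leaf; split_ifs at hq <;> omega
  obtain ⟨v, hv1, hv2⟩ := D.surj q 1
    ⟨by unfold Leaf at hL; omega, Or.inr (Or.inr (Or.inl ⟨hL, rfl⟩))⟩
  refine ⟨v, w, fun k hk => le_trans ?_ (hw v k hk)⟩
  unfold gT
  rw [hv1, hv2]
  unfold cd
  split_ifs at hq <;> split_ifs <;> omega

/-! Upper bounds after adding an edge -/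

/-- `x` is an extremal vertex of the arc of the tail at `q` of length `l`. -/
def Ext (r b x q l : ℕ) : Prop :=
  (x = 0 ∧ q = r ∧ l = 1) ∨
  (Leaf r b q ∧ l = 1 ∧ 1 ≤ x ∧ x + 2 + 2 * b ≤ 2 * r ∧
    (x + r = q ∨ x + r = q + 1 ∨ x = q + r ∨ x + 1 = q + r)) ∨
  (q + 1 + b = r ∧ l = b ∧ (x + 1 + 2 * b = 2 * r ∨ x + 2 = 2 * r))

lemma center {G' : SimpleGraph V} (hG : D.G ≤ G') (x q l : ℕ) (hx : Ext r b x q l)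
    (c t : V) (hc : D.pos c = x) (hc' : D.h c = 0) (ht : D.pos t = q) (ht' : D.h t = l)
    (hR : RR G' (r - 1) c t) (w : V) : RR G' (r - 1) c w := by
  have hr := D.hr
  have hb := D.hb
  have hbr := D.hbr
  have hw := D.vld w
  have hcv := (D.vld c).1
  by_cases h0 : D.h w = 0
  · refine ((D.cyc1 c w hc' h0).le hG).mono ?_
    have := hw.1
    unfold cd; omega
  by_cases hwt : D.pos w = q
  · by_cases h1 : D.h w = l
    · have : w = t := D.inj w t (by omega) (by omega) (by omega)
      rwa [this]
    · refine ((D.ct c w hc' (by omega)).le hG).mono ?_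
      rw [hc, hwt]
      unfold Ext Leaf at hx
      unfold Vld Leaf at hw
      unfold cd
      omega
  · by_cases hA : D.pos w = r
    · have hA1 : D.h w = 1 := by unfold Vld Leaf at hw; omega
      have h1 : RR D.G (min (cd r x r) (cd r x (r - 1)) + 1) c w := by
        rcases le_total (cd r x r) (cd r x (r - 1)) with h | h
        · rw [min_eq_left h]
          have := D.ct c w hc' (by omega)
          rwa [hc, hA1, hA] at this
        · rw [min_eq_right h]
          have := D.ctA c w hc' hA1 hA
          rwa [hc] at this
      refine (h1.le hG).mono ?_
      unfold Ext Leaf at hx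
      unfold cd
      omega
    · refine ((D.ct c w hc' (by omega)).le hG).mono ?_
      rw [hc]
      unfold Vld at hw
      obtain ⟨hw1, hw2⟩ := hw
      generalize D.pos w = p at *
      generalize D.h w = y at *
      unfold Ext Leaf at hx
      unfold Leaf at hw2
      unfold cd
      rcases hx with hx | hx | hx <;> omega

/-- Existence of a center from an arithmetic condition. -/
lemma short (u v : V) (huv : u ≠ v) (x q l k m : ℕ) (hx : Ext r b x q l)
    (hk : ∀ c, D.pos c = x → D.h c = 0 → (c = u ∨ D.pos u ≠ x ∨ 1 ≤ D.h u) → RR D.G k c u)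
    (hm : ∀ t, D.pos t = q → D.h t = l → RR D.G m v t) (hkm : k + m + 2 ≤ r) :
    ∃ c, ∀ w, RR (D.G ⊔ SimpleGraph.edge u v) (r - 1) c w := by
  have hr := D.hr
  have hb := D.hb
  have hbr := D.hbr
  have hxv : x < 2 * r - 1 := by unfold Ext at hx; omega
  have hql : Vld r b q l := by
    unfold Ext at hx
    unfold Vld
    rcases hx with ⟨h1, h2, h3⟩ | ⟨h1, h2, h3⟩ | ⟨h1, h2, h3⟩
    · exact ⟨by omega, Or.inr (Or.inl ⟨h2, h3⟩)⟩
    · refine ⟨?_, Or.inr (Or.inr (Or.inl ⟨h1, h2⟩))⟩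
      unfold Leaf at h1; omega
    · exact ⟨by omega, Or.inr (Or.inr (Or.inr ⟨by omega, by omega, by omega⟩))⟩
  obtain ⟨t, ht1, ht2⟩ := D.surj q l hql
  have hG : D.G ≤ D.G ⊔ SimpleGraph.edge u v := le_sup_left
  have hadj : (D.G ⊔ SimpleGraph.edge u v).Adj u v := by
    simp [SimpleGraph.edge_adj, huv]
  obtain ⟨c, hc1, hc2, hc3⟩ : ∃ c, D.pos c = x ∧ D.h c = 0 ∧
      (c = u ∨ D.pos u ≠ x ∨ 1 ≤ D.h u) := by
    by_cases h : D.pos u = x ∧ D.h u = 0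
    · exact ⟨u, h.1, h.2, Or.inl rfl⟩
    · obtain ⟨c, h1, h2⟩ := D.surj x 0 ⟨hxv, Or.inl rfl⟩
      exact ⟨c, h1, h2, Or.inr (by omega)⟩
  refine ⟨c, D.center hG x q l hx c t hc1 hc2 ht1 ht2 ?_⟩
  have e1 := (hk c hc1 hc2 hc3).le hG
  have e2 := (hm t ht1 ht2).le hG
  exact ((e1.trans (RR.adj hadj)).trans e2).mono (by omega)

end Dat

lemma cd_cases (r p q : ℕ) (hp : p < 2 * r - 1) (hq : q < 2 * r - 1) :
    (cd r p q + p = q ∧ cd r p q + 1 ≤ r) ∨ (cd r p q + q = p ∧ cd r p q + 1 ≤ r) ∨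
    (cd r p q + q + 1 = 2 * r + p ∧ cd r p q + 1 ≤ r) ∨
    (cd r p q + p + 1 = 2 * r + q ∧ cd r p q + 1 ≤ r) := by
  unfold cd
  omega

namespace Dat

variable {V : Type*} {r b : ℕ} (D : Dat V r b)

def CC (u v : V) : Prop := ∃ c, ∀ w, RR (D.G ⊔ SimpleGraph.edge u v) (r - 1) c w

lemma CC_symm {u v : V} (h : D.CC u v) : D.CC v u := by
  unfold CC at *
  rwa [SimpleGraph.edge_comm]

/-- distance estimate from a cycle position to a vertex -/
lemma hk0 (u : V) (x : ℕ) (c : V) (h1 : D.pos c = x) (h2 : D.h c = 0)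
    (h3 : c = u ∨ D.pos u ≠ x ∨ 1 ≤ D.h u) : RR D.G (cd r x (D.pos u) + D.h u) c u := by
  by_cases hu : D.h u = 0
  · have := D.cyc c u h2 hu (by rcases h3 with h | h | h
                                · exact Or.inl h
                                · right; omega
                                · omega)
    rw [h1] at this
    exact this.mono (by omega)
  · have := D.ct c u h2 (by omega)
    rwa [h1] at this

lemma hkA (u : V) (x : ℕ) (hu : D.h u = 1) (hu' : D.pos u = r) (c : V) (h1 : D.pos c = x)
    (h2 : D.h c = 0) : RR D.G (cd r x (r - 1) + 1) c u := by
  have := D.ctA c u h2 hu hu'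
  rwa [h1] at this

lemma sC (u v : V) (huv : u ≠ v) (x q l : ℕ) (hx : Ext r b x q l) (hv : D.h v = 0)
    (hl : 1 ≤ l) (h : cd r x (D.pos u) + D.h u + (cd r (D.pos v) q + l) + 2 ≤ r) :
    D.CC u v := by
  refine D.short u v huv x q l _ _ hx (D.hk0 u x) ?_ h
  intro t h1 h2
  have := D.ct v t hv (by omega)
  rwa [h1, h2] at this

lemma sCA (u v : V) (huv : u ≠ v) (hv : D.h v = 0)
    (h : cd r 0 (D.pos u) + D.h u + (cd r (D.pos v) (r - 1) + 1) + 2 ≤ r) :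
    D.CC u v := by
  refine D.short u v huv 0 r 1 _ _ (Or.inl ⟨rfl, rfl, rfl⟩) (D.hk0 u 0) ?_ h
  intro t h1 h2
  exact D.ctA v t hv h2 h1

lemma sT (u v : V) (huv : u ≠ v) (x q l : ℕ) (hx : Ext r b x q l) (hv : 1 ≤ D.h v)
    (hv' : D.pos v = q)
    (h : cd r x (D.pos u) + D.h u + ((D.h v - l) + (l - D.h v)) + 2 ≤ r) :
    D.CC u v := by
  refine D.short u v huv x q l _ _ hx (D.hk0 u x) ?_ h
  intro t h1 h2
  have := D.same v t (by omega) (Or.inl hv)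
  rwa [h2] at this

lemma sTA (u v : V) (huv : u ≠ v) (x q l : ℕ) (hx : Ext r b x q l) (hv : 1 ≤ D.h v)
    (hv' : D.pos v = q) (hu : D.h u = 1) (hu' : D.pos u = r)
    (h : cd r x (r - 1) + 1 + ((D.h v - l) + (l - D.h v)) + 2 ≤ r) :
    D.CC u v := by
  refine D.short u v huv x q l _ _ hx (fun c h1 h2 _ => D.hkA u x hu hu' c h1 h2) ?_ h
  intro t h1 h2
  have := D.same v t (by omega) (Or.inl hv)
  rwa [h2] at this

set_option maxHeartbeats 2000000 in
lemma chord (u v : V) (hu : D.h u = 0) (hv : D.h v = 0) (hlt : D.pos u + 2 ≤ D.pos v)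
    (hn : D.pos u + 2 * r - 2 ≠ D.pos v) : D.CC u v := by
  have hr := D.hr
  have hb := D.hb
  have hbr := D.hbr
  have hu1 := (D.vld u).1
  have hv1 := (D.vld v).1
  have hne : u ≠ v := by rintro rfl; omega
  have hA : Ext r b 0 r 1 := Or.inl ⟨rfl, rfl, rfl⟩
  have hC1 : Ext r b 1 (r + 1) 1 := Or.inr (Or.inl (by unfold Leaf; omega))
  have hC2 : Ext r b 2 (r + 1) 1 := Or.inr (Or.inl (by unfold Leaf; omega))
  by_cases c1 : D.pos v ≤ r - 1
  · apply D.sCA u v hne hv; unfold cd; omega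
  by_cases c2 : r ≤ D.pos u
  · apply D.CC_symm; apply D.sC v u hne.symm 0 r 1 hA hu le_rfl; unfold cd; omega
  by_cases c3 : D.pos u + D.pos v ≤ 2 * r - 3
  · apply D.sC u v hne 0 r 1 hA hv le_rfl; unfold cd; omega
  by_cases c4 : 2 * r + 1 ≤ D.pos u + D.pos v
  · apply D.CC_symm; apply D.sCA v u hne.symm hu; unfold cd; omega
  by_cases c6 : D.pos u = 1 ∧ D.pos v = r
  · have h3 : r = 3 := by omega
    have hB : Ext r b 3 1 1 := Or.inr (Or.inr (by omega))
    apply D.CC_symm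
    apply D.sC v u hne.symm 3 1 1 hB hu le_rfl
    unfold cd; omega
  by_cases c5 : D.pos u ≤ 1
  · apply D.sC u v hne 1 (r + 1) 1 hC1 hv le_rfl
    have e1 : D.pos u = 1 := by omega
    have e2 : cd r 1 1 = 0 := by unfold cd; omega
    have e3 : cd r (D.pos v) (r + 1) + 3 ≤ r := by
      have : r + 1 ≤ D.pos v := by omega
      unfold cd; omega
    rw [e1, e2]; omega
  · apply D.sC u v hne 2 (r + 1) 1 hC2 hv le_rfl; unfold cd; omega

lemma vcases (v : V) (h : 1 ≤ D.h v) : (D.pos v = r ∧ D.h v = 1) ∨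
    (Leaf r b (D.pos v) ∧ D.h v = 1) ∨ (D.pos v + 1 + b = r ∧ D.h v ≤ b) := by
  have := (D.vld v).2
  rcases this with h1 | h1 | h1 | h1
  · omega
  · exact Or.inl h1
  · exact Or.inr (Or.inl h1)
  · exact Or.inr (Or.inr ⟨h1.1, h1.2.2⟩)

/-- The two extremal vertices for a leaf. -/
lemma leafExt (q : ℕ) (hb : 1 ≤ b) (h : Leaf r b q) : ∃ x, Ext r b x q 1 ∧ Ext r b (x + 1) q 1 ∧
    (x + 1 + r = q + 1 ∧ r < q ∨ x + 1 = q + r ∧ q + 4 ≤ r) := by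
  unfold Leaf at h
  rcases h with h | h
  · refine ⟨q - r, ?_, ?_, ?_⟩
    · right; left; refine ⟨Or.inl h, ?_⟩; omega
    · right; left; refine ⟨Or.inl h, ?_⟩; omega
    · omega
  · refine ⟨q + r - 1, ?_, ?_, ?_⟩
    · right; left; refine ⟨Or.inr h, ?_⟩; omega
    · right; left; refine ⟨Or.inr h, ?_⟩; omega
    · omega

set_option maxHeartbeats 2000000 in
lemma cycTail (u v : V) (hu : D.h u = 0) (hv : 1 ≤ D.h v) (hn : ¬ D.G.Adj u v) :
    D.CC u v := by
  have hr := D.hr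
  have hb := D.hb
  have hbr := D.hbr
  have hu1 := (D.vld u).1
  have hv1 := (D.vld v).1
  have hne : u ≠ v := by rintro rfl; omega
  have hn' : ¬ AdjP r (D.pos u) (D.h u) (D.pos v) (D.h v) := fun h => hn ⟨hne, h⟩
  unfold AdjP at hn'
  have hn1 : D.pos u = D.pos v → 2 ≤ D.h v := by clear hne; omega
  have hn2 : D.pos v = r → D.h v = 1 → D.pos u + 1 ≠ r := by clear hne; omega
  clear hn' hn
  rcases D.vcases v hv with ⟨h1, h2⟩ | ⟨h1, h2⟩ | ⟨h1, h2⟩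
  · apply D.sT u v hne 0 r 1 (Or.inl ⟨rfl, rfl, rfl⟩) hv h1
    unfold cd; omega
  · obtain ⟨x, hx1, hx2, hx⟩ := leafExt _ hb h1
    by_cases c : cd r x (D.pos u) + 2 ≤ r
    · apply D.sT u v hne x _ 1 hx1 hv rfl
      omega
    · apply D.sT u v hne (x + 1) _ 1 hx2 hv rfl
      have : D.pos u ≠ D.pos v := by omega
      have hq : D.pos v ≠ 0 ∨ D.pos v + 4 ≤ r := by unfold Leaf at h1; omega
      have hx3 : x + 1 < 2 * r - 1 := by omega
      clear h1 hx1 hx2 hn1 hn2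
      have d1 := cd_cases r x (D.pos u) (by omega) hu1
      have d2 := cd_cases r (x + 1) (D.pos u) hx3 hu1
      rw [hu, h2]
      rcases hx with hx | hx
      · omega
      · omega
  · by_cases c : D.pos u ≤ D.pos v
    · apply D.sT u v hne (2 * r - 2) _ b (Or.inr (Or.inr (by omega))) hv rfl
      unfold cd; omega
    by_cases c' : D.pos u ≤ 2 * r - 1 - 2 * b
    · apply D.sT u v hne (2 * r - 1 - 2 * b) _ b (Or.inr (Or.inr (by omega))) hv rfl
      unfold cd; omega
    · refine ⟨u, fun w => ?_⟩
      have hG : D.G ≤ D.G ⊔ SimpleGraph.edge u v := le_sup_left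
      have hadj : (D.G ⊔ SimpleGraph.edge u v).Adj u v := by
        simp [SimpleGraph.edge_adj, hne]
      have hw := D.vld w
      by_cases h0 : D.h w = 0
      · refine ((D.cyc1 u w hu h0).le hG).mono ?_
        have := hw.1
        unfold cd; omega
      rcases D.vcases w (by omega) with ⟨k1, k2⟩ | ⟨k1, k2⟩ | ⟨k1, k2⟩
      · refine ((D.ct u w hu (by omega)).le hG).mono ?_
        unfold cd; omega
      · refine ((D.ct u w hu (by omega)).le hG).mono ?_
        unfold Leaf at k1
        unfold cd; omega
      · refine ((RR.adj hadj).trans ((D.same v w (by omega) (by omega)).le hG)).mono ?_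
        omega

set_option maxHeartbeats 2000000 in
lemma tailTail (u v : V) (hne : u ≠ v) (hu : 1 ≤ D.h u) (hv : 1 ≤ D.h v)
    (hn : ¬ D.G.Adj u v) : D.CC u v := by
  have hr := D.hr
  have hb := D.hb
  have hbr := D.hbr
  have hu1 := (D.vld u).1
  have hv1 := (D.vld v).1
  have hn' : ¬ AdjP r (D.pos u) (D.h u) (D.pos v) (D.h v) := fun h => hn ⟨hne, h⟩
  unfold AdjP at hn'
  have hn1 : D.pos u = D.pos v → D.h u ≠ D.h v + 1 ∧ D.h v ≠ D.h u + 1 := by clear hne; omega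
  clear hn' hn
  have hinj := D.inj u v hu
  -- leaf against anything
  have leafAny : ∀ u v : V, u ≠ v → 1 ≤ D.h u → 1 ≤ D.h v → Leaf r b (D.pos v) → D.h v = 1 →
      D.CC u v := by
    clear hne hu hv hu1 hv1 hn1 hinj
    intro u v hne hu hv h1 h2
    have hinj := D.inj u v hu
    have hu1 := (D.vld u).1
    have hv1 := (D.vld v).1
    obtain ⟨x, hx1, hx2, hx⟩ := leafExt _ hb h1
    rcases D.vcases u hu with ⟨k1, k2⟩ | ⟨k1, k2⟩ | ⟨k1, k2⟩
    · by_cases c : r < D.pos v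
      · apply D.sTA u v hne (x + 1) _ 1 hx2 hv rfl k2 k1
        unfold Leaf at h1
        unfold cd; omega
      · apply D.sTA u v hne x _ 1 hx1 hv rfl k2 k1
        unfold Leaf at h1
        unfold cd; omega
    · have : D.pos u ≠ D.pos v := by
        intro h; exact hne (hinj h (by omega))
      by_cases c : cd r x (D.pos u) + 1 + ((D.h v - 1) + (1 - D.h v)) + 2 ≤ r
      · apply D.sT u v hne x _ 1 hx1 hv rfl
        omega
      · apply D.sT u v hne (x + 1) _ 1 hx2 hv rfl
        have hq : D.pos u + D.pos v ≠ 2 * D.pos v + 1 ∧ D.pos u + 1 ≠ D.pos v ∧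
            (D.pos u = 0 → D.pos v + 2 ≠ 2 * r) ∧ (D.pos v = 0 → D.pos u + 2 ≠ 2 * r) := by
          unfold Leaf at h1 k1; clear c hx hx1 hx2; omega
        clear h1 k1 hx1 hx2
        have d1 := cd_cases r x (D.pos u) (by omega) hu1
        have d2 := cd_cases r (x + 1) (D.pos u) (by omega) hu1
        rw [k2, h2]
        rcases hx with hx | hx
        · omega
        · omega
    · by_cases c : cd r x (D.pos u) + D.h u + ((D.h v - 1) + (1 - D.h v)) + 2 ≤ r
      · apply D.sT u v hne x _ 1 hx1 hv rfl
        omega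
      · apply D.sT u v hne (x + 1) _ 1 hx2 hv rfl
        have d1 := cd_cases r x (D.pos u) (by omega) hu1
        have d2 := cd_cases r (x + 1) (D.pos u) (by omega) hu1
        unfold Leaf at h1
        rw [h2]
        clear hx1 hx2
        rcases hx with hx | hx
        · omega
        · omega
  have AB : ∀ u v : V, u ≠ v → D.pos u = r → D.h u = 1 → 1 ≤ D.h v → D.pos v + 1 + b = r →
      D.h v ≤ b → D.CC u v := by
    clear hne hu hv hu1 hv1 hn1 hinj
    intro u v hne h1 h2 h3 h4 h5
    by_cases c : D.h v < b
    · apply D.CC_symm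
      apply D.sT v u hne.symm 0 r 1 (Or.inl ⟨rfl, rfl, rfl⟩) (by omega) h1
      unfold cd; omega
    · have hx : Ext r b (2 * r - 1 - 2 * b) (D.pos v) b := Or.inr (Or.inr (by omega))
      by_cases c' : 2 * b + 1 ≤ r
      · apply D.sT u v hne (2 * r - 1 - 2 * b) _ b hx h3 rfl
        unfold cd; omega
      · apply D.sTA u v hne (2 * r - 1 - 2 * b) _ b hx h3 rfl h2 h1
        unfold cd; omega
  rcases D.vcases u hu with ⟨h1, h2⟩ | ⟨h1, h2⟩ | ⟨h1, h2⟩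
  · rcases D.vcases v hv with ⟨k1, k2⟩ | ⟨k1, k2⟩ | ⟨k1, k2⟩
    · exact absurd (hinj (by omega) (by omega)) hne
    · exact leafAny u v hne hu hv k1 k2
    · exact AB u v hne h1 h2 hv k1 k2
  · exact D.CC_symm (leafAny v u hne.symm hv hu h1 h2)
  · rcases D.vcases v hv with ⟨k1, k2⟩ | ⟨k1, k2⟩ | ⟨k1, k2⟩
    · exact D.CC_symm (AB v u hne.symm k1 k2 hu h1 h2)
    · exact leafAny u v hne hu hv k1 k2
    · have : D.h u ≠ D.h v := fun h => hne (hinj (by omega) h)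
      have hx : Ext r b (2 * r - 2) (r - 1 - b) b := Or.inr (Or.inr (by omega))
      by_cases c : D.h u < D.h v
      · apply D.sT u v hne (2 * r - 2) _ b hx hv (by omega)
        unfold cd; omega
      · apply D.CC_symm
        apply D.sT v u hne.symm (2 * r - 2) _ b hx hu (by omega)
        unfold cd; omega

set_option maxHeartbeats 2000000 in
lemma all (u v : V) (hne : u ≠ v) (hn : ¬ D.G.Adj u v) : D.CC u v := by
  have hu1 := (D.vld u).1
  have hv1 := (D.vld v).1
  by_cases hu : D.h u = 0
  · by_cases hv : D.h v = 0
    · have hn' : ¬ AdjP r (D.pos u) (D.h u) (D.pos v) (D.h v) := fun h => hn ⟨hne, h⟩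
      unfold AdjP at hn'
      have hc : 2 ≤ cd r (D.pos u) (D.pos v) := by omega
      unfold cd at hc
      by_cases c : D.pos u ≤ D.pos v
      · exact D.chord u v hu hv (by omega) (by omega)
      · exact D.CC_symm (D.chord v u hv hu (by omega) (by omega))
    · exact D.cycTail u v hu (by omega) hn
  · by_cases hv : D.h v = 0
    · exact D.CC_symm (D.cycTail v u hv (by omega) (fun h => hn h.symm))
    · exact D.tailTail u v hne (by omega) (by omega) hn

lemma zero_ecc (c w : V) (h1 : D.pos c = 0) (h2 : D.h c = 0) : RR D.G r c w := by
  have hr := D.hr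
  have hb := D.hb
  have hbr := D.hbr
  have hw := D.vld w
  by_cases h0 : D.h w = 0
  · refine (D.cyc1 c w h2 h0).mono ?_
    have := hw.1
    unfold cd; omega
  · refine (D.ct c w h2 (by omega)).mono ?_
    unfold Vld Leaf at hw
    rw [h1]
    unfold cd; omega

lemma radius_le [Fintype V] {G' : SimpleGraph V} {k : ℕ} (c : V) (h : ∀ w, RR G' k c w) :
    graphRadius G' ≤ k := by
  unfold graphRadius
  refine (ciInf_le (OrderBot.bddBelow _) c).trans ?_
  unfold eccentricity
  exact Finset.sup_le fun w _ => (h w).dist_le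

lemma le_dist {k : ℕ} (a c : V) (h : ∀ k', RR D.G k' a c → k ≤ k') : k ≤ D.G.dist a c := by
  have : Nonempty V := ⟨a⟩
  obtain ⟨w, hw⟩ := D.conn.exists_walk_length_eq_dist a c
  exact h _ ⟨w, hw.le⟩

theorem main [Fintype V] : RadiallyMaximal D.G ∧ graphRadius D.G = r ∧ graphDiam D.G = r + b := by
  have hr := D.hr
  have hb := D.hb
  have hbr := D.hbr
  obtain ⟨z, hz1, hz2⟩ := D.surj 0 0 ⟨by omega, Or.inl rfl⟩
  obtain ⟨y, hy1, hy2⟩ := D.surj 2 0 ⟨by omega, Or.inl rfl⟩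
  have : Nonempty V := ⟨z⟩
  have hrad : graphRadius D.G = r := by
    apply le_antisymm
    · exact radius_le z (fun w => D.zero_ecc z w hz1 hz2)
    · unfold graphRadius
      refine le_ciInf fun v => ?_
      obtain ⟨w, hw⟩ := D.far v
      exact (D.le_dist v w hw).trans (Finset.le_sup (f := fun u => D.G.dist v u) (Finset.mem_univ w))
  refine ⟨⟨D.conn, ?_, ?_⟩, hrad, ?_⟩
  · intro h
    have hzy : D.G.Adj z y := by
      rw [h, top_adj]; rintro rfl; omega
    have := hzy.2
    unfold AdjP cd at this
    omega
  · intro u v hne hn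
    obtain ⟨c, hc⟩ := D.all u v hne hn
    have := radius_le c hc
    omega
  · apply le_antisymm
    · exact Finset.sup_le fun v _ => Finset.sup_le fun w _ => (D.bound v w).dist_le
    · obtain ⟨v, w, hvw⟩ := D.diamLow
      refine (D.le_dist v w hvw).trans ?_
      refine le_trans ?_ (Finset.le_sup (f := fun v => eccentricity D.G v) (Finset.mem_univ v))
      exact Finset.le_sup (f := fun u => D.G.dist v u) (Finset.mem_univ w)

end Dat

def posF (r b k : ℕ) : ℕ :=
  if k < 2 * r - 1 then k
  else if k = 2 * r - 1 then r
  else if k < 3 * r - 1 - b then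
    (if 2 * k + 1 - 3 * r < 2 * r - 1 then 2 * k + 1 - 3 * r else 2 * k + 2 - 5 * r)
  else if k < 3 * r - 1 then r - 1 - b
  else 0

def hF (r b k : ℕ) : ℕ :=
  if k < 2 * r - 1 then 0
  else if k = 2 * r - 1 then 1
  else if k < 3 * r - 1 - b then 1
  else if k < 3 * r - 1 then k + b + 2 - 3 * r
  else 0

def datF (r b n : ℕ) (hr : 3 ≤ r) (hb : 1 ≤ b) (hbr : b + 2 ≤ r) (hn : 3 * r - 1 ≤ n) :
    Dat (Fin n) r b where
  pos v := posF r b v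
  h v := hF r b v
  hr := hr
  hb := hb
  hbr := hbr
  vld := by
    rintro ⟨v, hv⟩
    simp only [posF, hF, Vld, Leaf]
    split_ifs <;> omega
  surj := by
    rintro p k ⟨h1, h2⟩
    rcases h2 with h | h | ⟨h, h'⟩ | h
    · refine ⟨⟨p, by omega⟩, ?_⟩
      simp only [posF, hF]
      rw [if_pos h1, if_pos h1]; omega
    · refine ⟨⟨2 * r - 1, by omega⟩, ?_⟩
      simp only [posF, hF]
      split_ifs <;> omega
    · unfold Leaf at h
      rcases h with h | h
      · refine ⟨⟨(p + 3 * r - 1) / 2, by omega⟩, ?_⟩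
        simp only [posF, hF]
        split_ifs <;> omega
      · refine ⟨⟨(p + 5 * r - 2) / 2, by omega⟩, ?_⟩
        simp only [posF, hF]
        split_ifs <;> omega
    · refine ⟨⟨3 * r - 2 - b + k, by omega⟩, ?_⟩
      simp only [posF, hF]
      split_ifs <;> omega
  inj := by
    rintro ⟨v, hv⟩ ⟨w, hw⟩ h1 h2 h3
    simp only [posF, hF] at h1 h2 h3
    simp only [Fin.mk.injEq]
    split_ifs at * <;> omega

/-- For all positive integers `r`, `d`, `n` with `r < d ≤ 2r - 2` and `n ≥ 3r - 1`,
there is a radially maximal graph of radius `r`, diameter `d` and order `n`. -/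
theorem stmt_2 (r d n : ℕ) (hrd : r < d) (hd : d + 2 ≤ 2 * r) (hn : 3 * r - 1 ≤ n) :
    ∃ G : SimpleGraph (Fin n), RadiallyMaximal G ∧
      graphRadius G = r ∧ graphDiam G = d := by
  have e : d = r + (d - r) := by omega
  refine ⟨(datF r (d - r) n (by omega) (by omega) (by omega) hn).G, ?_⟩
  have := (datF r (d - r) n (by omega) (by omega) (by omega) hn).main
  rwa [← e] at this
end

section
/- Let G be a connected graph of order at least 2 and let v be a vertex of G. In the extension G{v} of G at v (with new vertex v'), every vertex u of G satisfies e_{G{v}}(u) = e_G(u), and moreover e_{G{v}}(v') = e_{G{v}}(v) = e_G(v). -/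
open SimpleGraph

/-- The extension of `G` at `v`: add a new vertex `none` adjacent to `v`
and to every neighbor of `v` in `G`. Old vertices are embedded via `some`. -/
def extensionAt {V : Type*} (G : SimpleGraph V) (v : V) : SimpleGraph (Option V) :=
  SimpleGraph.fromRel (fun x y => match x, y with
    | some a, some b => G.Adj a b
    | some a, none => a = v ∨ G.Adj a v
    | _, _ => False)

theorem aux_hom_dist {V W : Type*} {G : SimpleGraph V} {H : SimpleGraph W} (hG : G.Connected)
    (f : G →g H) (a b : V) : H.dist (f a) (f b) ≤ G.dist a b := by
  obtain ⟨p, hp⟩ := hG.exists_walk_length_eq_dist a b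
  rw [← hp, ← Walk.length_map f p]
  exact dist_le _

theorem aux_adj_ss {V : Type*} (G : SimpleGraph V) (v a b : V) :
    (extensionAt G v).Adj (some a) (some b) ↔ G.Adj a b := by
  simp only [extensionAt, SimpleGraph.fromRel_adj]
  constructor
  · rintro ⟨_, h | h⟩
    · exact h
    · exact h.symm
  · intro h
    exact ⟨by simpa using h.ne, Or.inl h⟩

theorem aux_adj_sn {V : Type*} (G : SimpleGraph V) (v a : V) :
    (extensionAt G v).Adj (some a) none ↔ (a = v ∨ G.Adj a v) := by
  simp [extensionAt, SimpleGraph.fromRel_adj]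

theorem aux_retract {V : Type*} (G : SimpleGraph V) (v : V) (hG : G.Connected) {x y : Option V}
    (p : (extensionAt G v).Walk x y) : G.dist (x.getD v) (y.getD v) ≤ p.length := by
  induction p with
  | nil => simp
  | @cons x y z h p ih =>
    have h1 : G.dist (x.getD v) (y.getD v) ≤ 1 := by
      rcases x with _ | a <;> rcases y with _ | b
      · simp
      · rcases (aux_adj_sn G v b).1 h.symm with h | h
        · simp [h]
        · simp [dist_eq_one_iff_adj.2 h.symm]
      · rcases (aux_adj_sn G v a).1 h with h | h
        · simp [h]
        · simp [dist_eq_one_iff_adj.2 h]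
      · simp [dist_eq_one_iff_adj.2 ((aux_adj_ss G v a b).1 h)]
    have h2 := hG.dist_triangle (u := x.getD v) (v := y.getD v) (w := z.getD v)
    rw [Walk.length_cons]
    omega

/-- In the extension `G{v}` of a connected graph `G` of order at least 2, every
old vertex keeps its eccentricity, and the new vertex `none` has the same
eccentricity as `v`. -/
theorem stmt_5 {V : Type*} [Fintype V] (G : SimpleGraph V) (v : V)
    (hconn : G.Connected) (hcard : 2 ≤ Fintype.card V) :
    (∀ u : V, eccentricity (extensionAt G v) (some u) = eccentricity G u) ∧
      eccentricity (extensionAt G v) none = eccentricity (extensionAt G v) (some v) ∧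
      eccentricity (extensionAt G v) (some v) = eccentricity G v := by
  classical
  have hnt : Nontrivial V := Fintype.one_lt_card_iff_nontrivial.1 (by omega)
  let f : G →g extensionAt G v := ⟨some, fun {a b} h => (aux_adj_ss G v a b).2 h⟩
  let s : G →g extensionAt G v := ⟨fun x => if x = v then none else some x, by
    intro a b h
    by_cases ha : a = v <;> by_cases hb : b = v
    · exact absurd (ha.trans hb.symm) h.ne
    · simp only [ha, hb, if_true, if_false]
      exact ((aux_adj_sn G v b).2 (Or.inr (ha ▸ h.symm))).symm
    · simp only [ha, hb, if_true, if_false]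
      exact (aux_adj_sn G v a).2 (Or.inr (hb ▸ h))
    · simp only [ha, hb, if_false]
      exact (aux_adj_ss G v a b).2 h⟩
  have hvn : (extensionAt G v).Adj (some v) none := (aux_adj_sn G v v).2 (Or.inl rfl)
  have hrv : ∀ x, (extensionAt G v).Reachable x (some v) := by
    rintro (_ | a)
    · exact hvn.symm.reachable
    · exact (hconn.preconnected a v).map f
  have hH : (extensionAt G v).Connected :=
    ⟨fun x y => (hrv x).trans (hrv y).symm⟩
  have hlow : ∀ x y, G.dist (x.getD v) (y.getD v) ≤ (extensionAt G v).dist x y := by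
    intro x y
    obtain ⟨p, hp⟩ := hH.exists_walk_length_eq_dist x y
    rw [← hp]
    exact aux_retract G v hconn p
  have hss : ∀ a b, (extensionAt G v).dist (some a) (some b) ≤ G.dist a b :=
    fun a b => aux_hom_dist hconn f a b
  have hsn : ∀ a, a ≠ v → (extensionAt G v).dist (some a) none ≤ G.dist a v := by
    intro a ha
    have := aux_hom_dist hconn s a v
    simpa [s, ha] using this
  have hle : ∀ a b, G.dist a b ≤ eccentricity G a := fun a b =>
    Finset.le_sup (f := fun u => G.dist a u) (Finset.mem_univ b)
  have hle' : ∀ a b, (extensionAt G v).dist a b ≤ eccentricity (extensionAt G v) a := fun a b =>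
    Finset.le_sup (f := fun u => (extensionAt G v).dist a u) (Finset.mem_univ b)
  have hone : (extensionAt G v).dist (some v) none ≤ eccentricity G v := by
    rw [dist_eq_one_iff_adj.2 hvn]
    obtain ⟨w, hw⟩ := exists_ne v
    exact (hconn.pos_dist_of_ne hw.symm).trans_le (hle v w)
  have main : ∀ u : V, eccentricity (extensionAt G v) (some u) = eccentricity G u := by
    intro u
    apply le_antisymm
    · refine Finset.sup_le ?_
      rintro (_ | b) -
      · by_cases hu : u = v
        · subst hu
          exact hone
        · exact (hsn u hu).trans (hle u v)
      · exact (hss u b).trans (hle u b)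
    · exact Finset.sup_le fun b _ => (hlow (some u) (some b)).trans (hle' _ _)
  have hnone : eccentricity (extensionAt G v) none = eccentricity G v := by
    apply le_antisymm
    · refine Finset.sup_le ?_
      rintro (_ | b) -
      · simp
      · rw [dist_comm]
        by_cases hb : b = v
        · subst hb
          exact hone
        · refine (hsn b hb).trans ?_
          rw [dist_comm]
          exact hle v b
    · exact Finset.sup_le fun b _ => (hlow none (some b)).trans (hle' _ _)
  exact ⟨main, hnone.trans (main v).symm, main v⟩
end
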